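/- arXiv:1708.06584 — 2 statements merged into one kernel-verified Lean document; each statement's English description precedes it below -/
import Mathlib

section
/- Let X ⊆ ℝⁿ be a Lebesgue measurable set of finite positive Lebesgue measure m(X). Then there exists a bijection x from the ordinals below the initial ordinal of cardinality card X onto X such that for every bounded Lebesgue measurable function f : X → ℝ, the mean 𝕄(f ∘ x) of the transfinite sequence f ∘ x exists and ∫_X f(t₁, …, t_n) dt₁ ⋯ dt_n = m(X) · 𝕄(f ∘ x). -/
open Ordinal

/-- The number `n` of full blocks in the standard decomposition `o = ω^σ·n + ρ`,
where `ω^σ = ω ^ log ω o` is the largest indecomposable ordinal `≤ o`. -/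
noncomputable def stdBlocks (o : Ordinal.{0}) : ℕ :=
  Cardinal.toNat (o / omega0 ^ log omega0 o).card

/-- The upper mean `M̄` of a transfinite sequence of reals.  A sequence of length `o`
is encoded as a total function `f : Ordinal → ℝ`; only the values of `f` at ordinals
`< o` are ever used.  It is defined by transfinite recursion on `o`:
(1) for `o = 1` it is `f 0`;
(2) for `o` indecomposable with `o > 1` (i.e. `o = ω^σ` with `σ > 0`) it is
    `limsup_{ξ → o} M̄(f|_ξ) = inf_{1 ≤ ζ < o} sup_{ζ ≤ ξ < o} M̄(f|_ξ)`;
(3) for decomposable `o`, writing `o = ω^σ·n + ρ` with `ρ < ω^σ`, it is the average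
    `(1/n) (M̄(s₀) + ⋯ + M̄(s_{n-1}))` of the upper means of the `n` consecutive
    blocks of `f` of length `ω^σ` (the remainder of length `ρ` is discarded). -/
noncomputable def upperMean (o : Ordinal.{0}) (f : Ordinal.{0} → ℝ) : ℝ :=
  if o = 1 then f 0
  else if h1 : 1 < o ∧ o = omega0 ^ log omega0 o then
    ⨅ ζ : Set.Ico (1 : Ordinal.{0}) o, ⨆ ξ : Set.Ico ζ.1 o, upperMean ξ.1 f
  else if h2 : 1 < o then
    ((stdBlocks o : ℝ))⁻¹ *
      ∑ i ∈ Finset.range (stdBlocks o),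
        upperMean (omega0 ^ log omega0 o)
          (fun ξ => f (omega0 ^ log omega0 o * (i : Ordinal) + ξ))
  else 0
termination_by o
decreasing_by
  · exact ξ.2.2
  · exact lt_of_le_of_ne (opow_log_le_self _ (zero_lt_one.trans h2).ne')
      fun h => h1 ⟨h2, h.symm⟩

/-- A transfinite sequence of reals of length `o` is bounded if its range
(on indices `< o`) is bounded in `ℝ`. -/
def SeqBounded (o : Ordinal.{0}) (f : Ordinal.{0} → ℝ) : Prop :=
  ∃ C : ℝ, ∀ ξ < o, |f ξ| ≤ C

/-- The concatenation `r ⊕ s` of a sequence `r` of length `a` with a sequence `s`: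
its first `a` entries are those of `r`, and its entry at `a + ξ'` is `s ξ'`. -/
noncomputable def concatSeq (a : Ordinal.{0}) (r s : Ordinal.{0} → ℝ) :
    Ordinal.{0} → ℝ :=
  fun ξ => if ξ < a then r ξ else s (ξ - a)

/-- An ordinal is indecomposable if it is nonzero and not the sum of two strictly
smaller ordinals. -/
def IsIndecomposable (o : Ordinal.{0}) : Prop :=
  o ≠ 0 ∧ ∀ b < o, ∀ c < o, b + c ≠ o

/-- The concatenation `s₀ ⊕ s₁ ⊕ ⋯ ⊕ s_{n-1}` of `n` sequences, each of length `β`;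
the result has length `β * n`. -/
noncomputable def concatN (β : Ordinal.{0}) :
    (n : ℕ) → (Fin n → Ordinal.{0} → ℝ) → Ordinal.{0} → ℝ
  | 0, _ => fun _ => 0
  | n + 1, s => concatSeq (β * n) (concatN β n (fun i => s i.castSucc)) (s (Fin.last n))

/-- `s / β`: given a sequence `s` whose length is `β * α`, the sequence of length `α`
whose `ι`-th entry is the upper mean of the `ι`-th consecutive block of `s` of
length `β`. -/
noncomputable def seqDiv (s : Ordinal.{0} → ℝ) (β : Ordinal.{0}) : Ordinal.{0} → ℝ :=
  fun ι => upperMean β (fun ξ => s (β * ι + ξ))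

/-- The lower mean `𝕄̲(s) = -M̄(-s)`. -/
noncomputable def lowerMean (o : Ordinal.{0}) (s : Ordinal.{0} → ℝ) : ℝ :=
  - upperMean o (fun ξ => - s ξ)

/-- A sequence `s` of length `o` has mean `c` when its upper and lower means both
equal `c`. -/
def HasMean (o : Ordinal.{0}) (s : Ordinal.{0} → ℝ) (c : ℝ) : Prop :=
  upperMean o s = c ∧ lowerMean o s = c

open MeasureTheory

namespace TransfiniteMean

open Set Filter Topology ProbabilityTheory
open scoped Cardinal

theorem upperMean_zero (f : Ordinal.{0} → ℝ) : upperMean 0 f = 0 := by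
  rw [upperMean]; simp

theorem upperMean_one (f : Ordinal.{0} → ℝ) : upperMean 1 f = f 0 := by
  rw [upperMean]; simp

theorem upperMean_opow {σ : Ordinal.{0}} (hσ : σ ≠ 0) (f : Ordinal.{0} → ℝ) :
    upperMean (ω ^ σ) f =
      ⨅ ζ : Set.Ico (1 : Ordinal.{0}) (ω ^ σ), ⨆ ξ : Set.Ico ζ.1 (ω ^ σ), upperMean ξ.1 f := by
  have h1 : (1 : Ordinal.{0}) < ω ^ σ := one_lt_opow.2 ⟨one_lt_omega0, hσ⟩
  rw [upperMean, if_neg h1.ne', dif_pos ⟨h1, by rw [log_opow one_lt_omega0]⟩]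

theorem upperMean_opow_mul_add (σ : Ordinal.{0}) {n : ℕ} (hn : n ≠ 0) {ρ : Ordinal.{0}}
    (hρ : ρ < ω ^ σ) (f : Ordinal.{0} → ℝ) :
    upperMean (ω ^ σ * n + ρ) f =
      (n : ℝ)⁻¹ * ∑ i ∈ Finset.range n, upperMean (ω ^ σ) (fun ξ => f (ω ^ σ * i + ξ)) := by
  have hpos : (0 : Ordinal.{0}) < ω ^ σ := opow_pos _ omega0_pos
  have hn' : (n : Ordinal.{0}) ≠ 0 := by exact_mod_cast hn
  have hlog : log ω (ω ^ σ * n + ρ) = σ := by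
    rw [log_opow_mul_add one_lt_omega0 hn' hρ, log_eq_zero (natCast_lt_omega0 n), add_zero]
  have hbl : stdBlocks (ω ^ σ * n + ρ) = n := by
    rw [stdBlocks, hlog, mul_add_div _ hpos.ne', div_eq_zero_of_lt hρ, add_zero]; simp
  have hle : ω ^ σ ≤ ω ^ σ * n + ρ :=
    (le_mul_left _ (Nat.pos_of_ne_zero hn |> fun h => by exact_mod_cast h)).trans le_self_add
  by_cases heq : ω ^ σ * n + ρ = ω ^ σ
  · have : n = 1 := by
      by_contra h1
      have h2 : 2 ≤ n := by omega
      have : ω ^ σ * 2 ≤ ω ^ σ * n + ρ :=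
        (mul_le_mul_right (by exact_mod_cast h2) _).trans le_self_add
      rw [heq] at this
      have h3 : ω ^ σ * 1 < ω ^ σ * 2 := (mul_lt_mul_iff_right₀ hpos).2 one_lt_two
      rw [mul_one] at h3
      exact absurd this h3.not_ge
    rw [heq, this]; simp
  · have h1 : 1 < ω ^ σ * n + ρ :=
      (Order.one_le_iff_pos.2 hpos).trans_lt (lt_of_le_of_ne hle (Ne.symm heq))
    rw [upperMean, if_neg h1.ne', dif_neg, dif_pos h1, hbl, hlog]
    rw [hlog]; exact fun h => heq h.2

theorem exists_eq_opow_mul_add {o : Ordinal.{0}} (ho : o ≠ 0) :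
    ∃ (σ : Ordinal.{0}) (n : ℕ) (ρ : Ordinal.{0}), n ≠ 0 ∧ ρ < ω ^ σ ∧ o = ω ^ σ * n + ρ := by
  obtain ⟨n, hn⟩ := lt_omega0.1 (div_opow_log_lt o one_lt_omega0)
  refine ⟨log ω o, n, o % ω ^ log ω o, ?_, mod_lt _ (opow_pos _ omega0_pos).ne', ?_⟩
  · rintro rfl
    have := div_opow_log_pos ω ho
    rw [hn] at this; simp at this
  · rw [← hn, div_add_mod]

/-- Induction along the recursive definition of the upper mean. -/
theorem ordinal_induction {P : Ordinal.{0} → Prop} (zero : P 0) (one : P 1)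
    (opow : ∀ σ : Ordinal.{0}, σ ≠ 0 → (∀ ξ < ω ^ σ, P ξ) → P (ω ^ σ))
    (blocks : ∀ (σ : Ordinal.{0}) (n : ℕ) (ρ : Ordinal.{0}), n ≠ 0 → ρ < ω ^ σ → P (ω ^ σ) →
      P (ω ^ σ * n + ρ)) (o : Ordinal.{0}) : P o := by
  induction o using WellFoundedLT.induction with
  | ind o ih =>
    rcases eq_or_ne o 0 with rfl | ho
    · exact zero
    obtain ⟨σ, n, ρ, hn, hρ, rfl⟩ := exists_eq_opow_mul_add ho
    apply blocks σ n ρ hn hρ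
    have hle : ω ^ σ ≤ ω ^ σ * n + ρ :=
      (le_mul_left _ (Nat.pos_of_ne_zero hn |> fun h => by exact_mod_cast h)).trans le_self_add
    rcases hle.lt_or_eq with h | h
    · exact ih _ h
    · rcases eq_or_ne σ 0 with rfl | hσ
      · simpa using one
      · exact opow σ hσ (by rwa [h])

theorem abs_upperMean_le {C : ℝ} (o : Ordinal.{0}) :
    ∀ f : Ordinal.{0} → ℝ, (∀ ξ, |f ξ| ≤ C) → |upperMean o f| ≤ C := by
  induction o using ordinal_induction with
  | zero => intro f hf; rw [upperMean_zero, abs_zero]; exact (abs_nonneg _).trans (hf 0)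
  | one => intro f hf; rw [upperMean_one]; exact hf 0
  | opow σ hσ ih =>
    intro f hf
    rw [upperMean_opow hσ]
    have h1 : (1 : Ordinal.{0}) < ω ^ σ := one_lt_opow.2 ⟨one_lt_omega0, hσ⟩
    have key : ∀ ζ : Set.Ico (1 : Ordinal.{0}) (ω ^ σ),
        |⨆ ξ : Set.Ico ζ.1 (ω ^ σ), upperMean ξ.1 f| ≤ C := by
      intro ζ
      have : Nonempty (Set.Ico ζ.1 (ω ^ σ)) := ⟨⟨ζ.1, le_rfl, ζ.2.2⟩⟩
      have hb : ∀ ξ : Set.Ico ζ.1 (ω ^ σ), |upperMean ξ.1 f| ≤ C := fun ξ => ih _ ξ.2.2 f hf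
      rw [abs_le]
      refine ⟨le_ciSup_of_le ⟨C, ?_⟩ ⟨ζ.1, le_rfl, ζ.2.2⟩ (abs_le.1 (hb ⟨ζ.1, le_rfl, ζ.2.2⟩)).1,
        ciSup_le fun ξ => (abs_le.1 (hb ξ)).2⟩
      rintro _ ⟨ξ, rfl⟩
      exact (abs_le.1 (hb ξ)).2
    have : Nonempty (Set.Ico (1 : Ordinal.{0}) (ω ^ σ)) := ⟨⟨1, le_rfl, h1⟩⟩
    rw [abs_le]
    refine ⟨le_ciInf fun ζ => (abs_le.1 (key ζ)).1,
      ciInf_le_of_le ⟨-C, ?_⟩ ⟨1, le_rfl, h1⟩ (abs_le.1 (key ⟨1, le_rfl, h1⟩)).2⟩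
    rintro _ ⟨ζ, rfl⟩
    exact (abs_le.1 (key ζ)).1
  | blocks σ n ρ hn hρ ih =>
    intro f hf
    rw [upperMean_opow_mul_add σ hn hρ, abs_mul, abs_inv, Nat.abs_cast]
    have hn' : (0 : ℝ) < n := by exact_mod_cast Nat.pos_of_ne_zero hn
    rw [inv_mul_le_iff₀ hn']
    refine (Finset.abs_sum_le_sum_abs _ _).trans ?_
    refine (Finset.sum_le_card_nsmul _ _ C fun i _ => ih _ fun ξ => hf _).trans ?_
    simp

section Limsup

variable {σ : Ordinal.{0}} {f : Ordinal.{0} → ℝ} {C p : ℝ}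

theorem upperMean_opow_le (hσ : σ ≠ 0) (hf : ∀ ξ, |f ξ| ≤ C) {ζ : Ordinal.{0}} (hζ : ζ < ω ^ σ)
    (h : ∀ ξ, ζ ≤ ξ → ξ < ω ^ σ → upperMean ξ f ≤ p) : upperMean (ω ^ σ) f ≤ p := by
  rw [upperMean_opow hσ]
  have h1 : (1 : Ordinal.{0}) < ω ^ σ := one_lt_opow.2 ⟨one_lt_omega0, hσ⟩
  have hm : max 1 ζ < ω ^ σ := max_lt h1 hζ
  refine ciInf_le_of_le ⟨-C, ?_⟩ ⟨max 1 ζ, le_max_left _ _, hm⟩ ?_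
  · rintro _ ⟨ζ, rfl⟩
    refine le_ciSup_of_le ⟨C, ?_⟩ ⟨ζ.1, le_rfl, ζ.2.2⟩ (abs_le.1 (abs_upperMean_le ζ.1 f hf)).1
    rintro _ ⟨ξ, rfl⟩
    exact (abs_le.1 (abs_upperMean_le ξ.1 f hf)).2
  · have : Nonempty (Set.Ico (max 1 ζ) (ω ^ σ)) := ⟨⟨_, le_rfl, hm⟩⟩
    exact ciSup_le fun ξ => h _ ((le_max_right _ _).trans ξ.2.1) ξ.2.2

theorem exists_forall_upperMean_lt (hσ : σ ≠ 0) (hf : ∀ ξ, |f ξ| ≤ C)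
    (h : upperMean (ω ^ σ) f < p) :
    ∃ ζ < ω ^ σ, ∀ ξ, ζ ≤ ξ → ξ < ω ^ σ → upperMean ξ f < p := by
  rw [upperMean_opow hσ] at h
  have h1 : (1 : Ordinal.{0}) < ω ^ σ := one_lt_opow.2 ⟨one_lt_omega0, hσ⟩
  have : Nonempty (Set.Ico (1 : Ordinal.{0}) (ω ^ σ)) := ⟨⟨1, le_rfl, h1⟩⟩
  obtain ⟨ζ, hζ⟩ := exists_lt_of_ciInf_lt h
  refine ⟨ζ.1, ζ.2.2, fun ξ h2 h3 => lt_of_le_of_lt ?_ hζ⟩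
  refine le_ciSup (f := fun ξ : Set.Ico ζ.1 (ω ^ σ) => upperMean ξ.1 f) ⟨C, ?_⟩ ⟨ξ, h2, h3⟩
  rintro _ ⟨ξ, rfl⟩
  exact (abs_le.1 (abs_upperMean_le ξ.1 f hf)).2

end Limsup

theorem upperMean_le_add {Cf Cg Ch : ℝ} (o : Ordinal.{0}) :
    ∀ f g h : Ordinal.{0} → ℝ, (∀ ξ, |f ξ| ≤ Cf) → (∀ ξ, |g ξ| ≤ Cg) → (∀ ξ, |h ξ| ≤ Ch) →
      (∀ ξ, h ξ ≤ f ξ + g ξ) → upperMean o h ≤ upperMean o f + upperMean o g := by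
  induction o using ordinal_induction with
  | zero => intros; simp [upperMean_zero]
  | one => intro f g h _ _ _ H; simpa [upperMean_one] using H 0
  | opow σ hσ ih =>
    intro f g h hf hg hh H
    refine le_of_forall_pos_le_add fun ε hε => ?_
    obtain ⟨ζ₁, h1, h1'⟩ := exists_forall_upperMean_lt (p := upperMean (ω ^ σ) f + ε / 2) hσ hf
      (by linarith)
    obtain ⟨ζ₂, h2, h2'⟩ := exists_forall_upperMean_lt (p := upperMean (ω ^ σ) g + ε / 2) hσ hg
      (by linarith)
    refine upperMean_opow_le hσ hh (max_lt h1 h2) fun ξ h3 h4 => ?_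
    have := ih ξ h4 f g h hf hg hh H
    have := h1' ξ ((le_max_left _ _).trans h3) h4
    have := h2' ξ ((le_max_right _ _).trans h3) h4
    linarith
  | blocks σ n ρ hn hρ ih =>
    intro f g h hf hg hh H
    simp only [upperMean_opow_mul_add σ hn hρ]
    rw [← mul_add, ← Finset.sum_add_distrib]
    gcongr with i
    exact ih _ _ _ (fun ξ => hf _) (fun ξ => hg _) (fun ξ => hh _) fun ξ => H _

theorem upperMean_zero_seq (o : Ordinal.{0}) : upperMean o (fun _ => 0) = 0 := by
  have := abs_upperMean_le (C := 0) o (fun _ => 0) (by simp)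
  simpa using this

theorem upperMean_mono {Cf Ch : ℝ} (o : Ordinal.{0}) {f h : Ordinal.{0} → ℝ}
    (hf : ∀ ξ, |f ξ| ≤ Cf) (hh : ∀ ξ, |h ξ| ≤ Ch) (H : ∀ ξ, h ξ ≤ f ξ) :
    upperMean o h ≤ upperMean o f := by
  simpa [upperMean_zero_seq] using upperMean_le_add (Cg := 0) o f (fun _ => 0) h hf (by simp) hh
    (by simpa using H)

/-- If all consecutive full blocks of length `ω ^ τ` have upper mean at most `p`, then so does
every longer initial segment. -/
theorem upperMean_le_of_blocks {τ : Ordinal.{0}} {C p : ℝ} (ξ : Ordinal.{0}) :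
    ∀ g : Ordinal.{0} → ℝ, (∀ ζ, |g ζ| ≤ C) → ω ^ τ ≤ ξ →
      (∀ δ, ω ^ τ * δ + ω ^ τ ≤ ξ → upperMean (ω ^ τ) (fun ζ => g (ω ^ τ * δ + ζ)) ≤ p) →
      upperMean ξ g ≤ p := by
  have hτ0 : (0 : Ordinal.{0}) < ω ^ τ := opow_pos _ omega0_pos
  induction ξ using ordinal_induction with
  | zero => intro g _ h; exact absurd h hτ0.not_ge
  | one =>
    intro g _ h H
    have : ω ^ τ = (1 : Ordinal.{0}) := le_antisymm h (Order.one_le_iff_pos.2 hτ0)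
    simpa [this] using H 0 (by simp [this])
  | opow σ hσ ih =>
    intro g hg h H
    rcases h.eq_or_lt with h | h
    · have := H 0 (by rw [mul_zero, ← h, zero_add])
      simpa [h] using this
    · exact upperMean_opow_le hσ hg h fun ξ h1 h2 =>
        ih ξ h2 g hg h1 fun δ hδ => H δ (hδ.trans h2.le)
  | blocks σ n ρ hn hρ ih =>
    intro g hg h H
    have hn' : (0 : ℝ) < n := by exact_mod_cast Nat.pos_of_ne_zero hn
    have hτσ : τ ≤ σ := by
      have h1 : ω ^ σ * n + ρ < ω ^ (Order.succ σ) := by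
        rw [lt_omega0_opow_succ]
        refine ⟨n + 1, ?_⟩
        rw [Nat.cast_add, Nat.cast_one, mul_add, mul_one]
        exact (add_lt_add_iff_left _).2 hρ
      exact Order.lt_succ_iff.1 ((opow_lt_opow_iff_right one_lt_omega0).1 (h.trans_lt h1))
    rw [upperMean_opow_mul_add σ hn hρ, inv_mul_le_iff₀ hn']
    refine (Finset.sum_le_card_nsmul _ _ p fun i hi => ?_).trans (by simp)
    refine ih _ (fun ξ => hg _) (opow_le_opow_right omega0_pos hτσ) fun δ hδ => ?_
    have hsplit : ω ^ σ = ω ^ τ * ω ^ (σ - τ) := by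
      rw [← opow_add, Ordinal.add_sub_cancel_of_le hτσ]
    have := H (ω ^ (σ - τ) * i + δ) ?_
    · simpa only [mul_add, ← mul_assoc, ← hsplit, add_assoc] using this
    · rw [mul_add, ← mul_assoc, ← hsplit, add_assoc]
      calc ω ^ σ * i + (ω ^ τ * δ + ω ^ τ) ≤ ω ^ σ * i + ω ^ σ := by gcongr
        _ = ω ^ σ * ((i + 1 : ℕ) : Ordinal.{0}) := by
          rw [Nat.cast_add, Nat.cast_one, mul_add, mul_one]
        _ ≤ ω ^ σ * n := by
          have : i + 1 ≤ n := Finset.mem_range.1 hi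
          exact mul_le_mul_right (by exact_mod_cast this) _
        _ ≤ _ := le_self_add

/-- If all but finitely many consecutive blocks of length `ω ^ σ` of a sequence of length
`ω ^ (σ + 1)` have upper mean at most `p`, then so does the sequence. -/
theorem upperMean_opow_succ_le {σ : Ordinal.{0}} {C p : ℝ} {g : Ordinal.{0} → ℝ}
    (hg : ∀ ζ, |g ζ| ≤ C) (m : ℕ)
    (H : ∀ i : ℕ, m ≤ i → upperMean (ω ^ σ) (fun ζ => g (ω ^ σ * i + ζ)) ≤ p) :
    upperMean (ω ^ Order.succ σ) g ≤ p := by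
  have hC : 0 ≤ C := (abs_nonneg _).trans (hg 0)
  refine le_of_forall_pos_le_add fun ε hε => ?_
  obtain ⟨N, hN⟩ := exists_nat_gt (max 1 (m * (C + |p|) / ε))
  have hN1 : (1 : ℝ) < N := (le_max_left _ _).trans_lt hN
  have hN2 : m * (C + |p|) < N * ε := (div_lt_iff₀ hε).1 ((le_max_right _ _).trans_lt hN)
  have hN0 : 0 < N := by exact_mod_cast zero_lt_one.trans hN1
  refine upperMean_opow_le (Order.succ_ne_bot σ) hg
    (lt_omega0_opow_succ.2 ⟨N + 1, ?_⟩ : ω ^ σ * N < _) fun ξ h1 h2 => ?_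
  · exact (mul_lt_mul_iff_right₀ (opow_pos _ omega0_pos)).2 (by exact_mod_cast Nat.lt_succ_self N)
  have hσξ : ω ^ σ ≤ ξ := (le_mul_left _ (by exact_mod_cast hN0)).trans h1
  have hξ0 : ξ ≠ 0 := ((opow_pos _ omega0_pos).trans_le hσξ).ne'
  obtain ⟨n, ρ, hn, hρ, rfl⟩ : ∃ (n : ℕ) (ρ : Ordinal.{0}), n ≠ 0 ∧ ρ < ω ^ σ ∧
      ξ = ω ^ σ * n + ρ := by
    obtain ⟨σ', n, ρ, hn, hρ, h⟩ := exists_eq_opow_mul_add hξ0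
    have e1 : log ω ξ = σ := (log_eq_iff one_lt_omega0 hξ0 σ).2 ⟨hσξ, h2⟩
    have e2 : log ω ξ = σ' := by
      rw [h, log_opow_mul_add one_lt_omega0 (by exact_mod_cast hn) hρ,
        log_eq_zero (natCast_lt_omega0 n), add_zero]
    obtain rfl : σ = σ' := e1.symm.trans e2
    exact ⟨n, ρ, hn, hρ, h⟩
  have hNn : N ≤ n := by
    by_contra! hlt
    refine absurd h1 (not_le.2 ?_)
    calc ω ^ σ * n + ρ < ω ^ σ * n + ω ^ σ := (add_lt_add_iff_left _).2 hρ
      _ = ω ^ σ * ((n + 1 : ℕ) : Ordinal.{0}) := by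
          rw [Nat.cast_add, Nat.cast_one, mul_add, mul_one]
      _ ≤ ω ^ σ * N := by
          have : n + 1 ≤ N := hlt
          exact mul_le_mul_right (by exact_mod_cast this) _
  have hn' : (0 : ℝ) < n := by exact_mod_cast Nat.pos_of_ne_zero hn
  rw [upperMean_opow_mul_add σ hn hρ, inv_mul_le_iff₀ hn']
  have hterm : ∀ i ∈ Finset.range n, upperMean (ω ^ σ) (fun ζ => g (ω ^ σ * i + ζ)) ≤
      p + if i < m then C + |p| else 0 := by
    intro i _
    split_ifs with hi
    · have := (abs_le.1 (abs_upperMean_le (ω ^ σ) (fun ζ => g (ω ^ σ * i + ζ)) fun ζ => hg _)).2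
      linarith [neg_abs_le p]
    · rw [add_zero]; exact H i (not_lt.1 hi)
  refine (Finset.sum_le_sum hterm).trans ?_
  rw [Finset.sum_add_distrib, ← Finset.sum_filter, Finset.sum_const, Finset.sum_const,
    Finset.card_range]
  simp only [_root_.nsmul_eq_mul]
  rw [mul_add]
  have hcard : ((Finset.filter (fun i => i < m) (Finset.range n)).card : ℝ) ≤ m := by
    have : (Finset.filter (fun i => i < m) (Finset.range n)) ⊆ Finset.range m := by
      intro i hi; simpa using (Finset.mem_filter.1 hi).2
    simpa using Finset.card_le_card this
  have h3 : ((Finset.filter (fun i => i < m) (Finset.range n)).card : ℝ) * (C + |p|) ≤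
      m * (C + |p|) := mul_le_mul_of_nonneg_right hcard (by positivity)
  have h4 : (N : ℝ) * ε ≤ n * ε :=
    mul_le_mul_of_nonneg_right (by exact_mod_cast hNn) hε.le
  linarith

/-- A bounded number of bad blocks does not affect the upper mean of much longer initial
segments. -/
theorem upperMean_le_of_eventually_blocks {τ : Ordinal.{0}} {C p : ℝ} {ξ δ₀ : Ordinal.{0}}
    (hδ₀ : δ₀ ≠ 0) {g : Ordinal.{0} → ℝ} (hg : ∀ ζ, |g ζ| ≤ C) (hξ : ω ^ τ * δ₀ * ω ≤ ξ)
    (H : ∀ δ, δ₀ ≤ δ → ω ^ τ * δ + ω ^ τ ≤ ξ →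
      upperMean (ω ^ τ) (fun ζ => g (ω ^ τ * δ + ζ)) ≤ p) :
    upperMean ξ g ≤ p := by
  have hτ0 : (0 : Ordinal.{0}) < ω ^ τ := opow_pos _ omega0_pos
  have hne : ω ^ τ * δ₀ ≠ 0 := mul_ne_zero hτ0.ne' hδ₀
  set σ := log ω (ω ^ τ * δ₀) with hσ
  have hmul : ω ^ τ * δ₀ * ω = ω ^ Order.succ σ := by
    rw [hσ, ← mul_eq_opow_log_succ hne isPrincipal_mul_omega0]
    exact natCast_lt_omega0 2
  rw [hmul] at hξ
  have hτσ : τ ≤ σ := by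
    refine le_log_of_opow_le one_lt_omega0 ?_
    exact le_mul_left _ (pos_of_ne_zero hδ₀)
  have hlt : ω ^ τ * δ₀ < ω ^ Order.succ σ := lt_opow_succ_log_self one_lt_omega0 _
  have later : ∀ (σ' i : Ordinal.{0}), τ ≤ σ' → ω ^ τ * δ₀ ≤ ω ^ σ' * i →
      ω ^ σ' * i + ω ^ σ' ≤ ξ → upperMean (ω ^ σ') (fun ζ => g (ω ^ σ' * i + ζ)) ≤ p := by
    intro σ' i hσ' h1 h2
    have hsplit : ω ^ σ' = ω ^ τ * ω ^ (σ' - τ) := by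
      rw [← opow_add, Ordinal.add_sub_cancel_of_le hσ']
    refine upperMean_le_of_blocks _ _ (fun ζ => hg _) (opow_le_opow_right omega0_pos hσ')
      fun δ hδ => ?_
    have := H (ω ^ (σ' - τ) * i + δ) ?_ ?_
    · simpa only [mul_add, ← mul_assoc, ← hsplit, add_assoc] using this
    · rw [hsplit, mul_assoc] at h1
      exact ((mul_le_mul_iff_right₀ hτ0).1 h1).trans le_self_add
    · rw [mul_add, ← mul_assoc, ← hsplit, add_assoc]
      exact le_trans (by gcongr) h2
  refine upperMean_le_of_blocks (τ := Order.succ σ) ξ g hg hξ fun δ hδ => ?_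
  rcases eq_or_ne δ 0 with rfl | hδ0
  · simp only [mul_zero, zero_add]
    obtain ⟨m, hm⟩ := lt_omega0_opow_succ.1 hlt
    refine upperMean_opow_succ_le hg m fun i hi => later σ i hτσ (hm.le.trans ?_) (le_trans ?_ hξ)
    · exact mul_le_mul_right (by exact_mod_cast hi) _
    · refine (lt_omega0_opow_succ.2 ⟨i + 2, ?_⟩).le
      rw [← mul_add_one]
      exact (mul_lt_mul_iff_right₀ (opow_pos _ omega0_pos)).2 (by exact_mod_cast Nat.lt_succ_self _)
  · exact later _ δ (hτσ.trans (Order.le_succ σ))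
      (hlt.le.trans (le_mul_left _ (pos_of_ne_zero hδ0))) hδ

theorem upperMean_natCast {n : ℕ} (hn : n ≠ 0) (g : Ordinal.{0} → ℝ) :
    upperMean n g = (n : ℝ)⁻¹ * ∑ i ∈ Finset.range n, g i := by
  have := upperMean_opow_mul_add 0 hn (ρ := 0) (by simp) g
  simpa [upperMean_one] using this

theorem upperMean_omega0_le {C p : ℝ} {g : Ordinal.{0} → ℝ} (hg : ∀ ξ, |g ξ| ≤ C)
    (h : Tendsto (fun n : ℕ => (∑ i ∈ Finset.range n, g i) / n) atTop (𝓝 p)) :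
    upperMean ω g ≤ p := by
  refine le_of_forall_pos_le_add fun ε hε => ?_
  obtain ⟨N, hN⟩ := (h.eventually_le_const (lt_add_of_pos_right p hε)).exists_forall_of_atTop
  rw [← opow_one ω]
  refine upperMean_opow_le one_ne_zero hg
    (by rw [opow_one]; exact natCast_lt_omega0 (N + 1)) fun ξ h1 h2 => ?_
  rw [opow_one] at h2
  obtain ⟨n, rfl⟩ := lt_omega0.1 h2
  have h1' : N + 1 ≤ n := by exact_mod_cast h1
  rw [upperMean_natCast (by omega), inv_mul_eq_div]
  exact hN n (by omega)

theorem exists_coverMap {l δ : Ordinal.{0}} (h : δ.card ≤ l.card) :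
    ∃ e : Ordinal.{0} → Ordinal.{0}, ∀ α, α < l ∨ α < δ → ∃ ζ < l, e ζ = α := by
  have hcard : Cardinal.mk (Iio (max l δ)) ≤ Cardinal.mk (Iio l) := by
    rw [Cardinal.mk_Iio_ordinal, Cardinal.mk_Iio_ordinal, Cardinal.lift_le]
    rcases le_total l δ with h' | h'
    · rwa [max_eq_right h']
    · rw [max_eq_left h']
  obtain ⟨f⟩ := hcard
  refine ⟨fun ζ => sInf {α | ∃ h : α ∈ Iio (max l δ), (f ⟨α, h⟩ : Ordinal.{0}) = ζ}, fun α hα => ?_⟩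
  have hα' : α ∈ Iio (max l δ) := lt_max_iff.2 hα
  refine ⟨f ⟨α, hα'⟩, (f ⟨α, hα'⟩).2, ?_⟩
  have : {β | ∃ h : β ∈ Iio (max l δ), (f ⟨β, h⟩ : Ordinal.{0}) = f ⟨α, hα'⟩} = {α} := by
    ext β
    simp only [mem_ofPred_eq, mem_singleton_iff]
    constructor
    · rintro ⟨hβ, h⟩
      simpa using f.injective (Subtype.ext h)
    · rintro rfl; exact ⟨hα', rfl⟩
  simp only [this, csInf_singleton]

/-- A map from ordinals to ordinals sending the ordinals below `l` onto a set containing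
all ordinals below `l` and all those below `δ`, whenever there is one. -/
noncomputable def coverMap (l δ : Ordinal.{0}) : Ordinal.{0} → Ordinal.{0} :=
  Classical.epsilon fun e => ∀ α, α < l ∨ α < δ → ∃ ζ < l, e ζ = α

/-- A finite set of ordinals attached to each ordinal `γ`, such that every given `α` belongs
to it for most `γ`, in the sense of upper means. -/
noncomputable def testSet (γ : Ordinal.{0}) : Set Ordinal.{0} :=
  if _h : γ < ω then Iio γ
  else coverMap γ.card.ord (γ / γ.card.ord) '' testSet (γ % γ.card.ord)
termination_by γ
decreasing_by
  have h0 : γ.card.ord ≠ 0 := by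
    rw [Ne, Cardinal.ord_eq_zero, card_eq_zero]
    rintro rfl
    exact _h omega0_pos
  exact (mod_lt _ h0).trans_le (Cardinal.ord_card_le γ)

theorem finite_testSet (γ : Ordinal.{0}) : (testSet γ).Finite := by
  induction γ using WellFoundedLT.induction with
  | ind γ ih =>
    rw [testSet]
    split_ifs with h
    · obtain ⟨n, rfl⟩ := lt_omega0.1 h
      refine (Set.finite_range fun i : Fin n => ((i : ℕ) : Ordinal.{0})).subset ?_
      intro α hα
      obtain ⟨m, rfl⟩ := lt_omega0.1 ((mem_Iio.1 hα).trans h)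
      exact ⟨⟨m, by exact_mod_cast mem_Iio.1 hα⟩, rfl⟩
    · refine (ih _ ?_).image _
      have h0 : γ.card.ord ≠ 0 := by
        rw [Ne, Cardinal.ord_eq_zero, card_eq_zero]
        rintro rfl
        exact h omega0_pos
      exact (mod_lt _ h0).trans_le (Cardinal.ord_card_le γ)

theorem testSet_of_lt_omega0 {γ : Ordinal.{0}} (h : γ < ω) : testSet γ = Iio γ := by
  rw [testSet, dif_pos h]

theorem testSet_mul_add {ν : Cardinal.{0}} (hν : Cardinal.aleph0 ≤ ν) {δ ε : Ordinal.{0}}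
    (hδ : δ ≠ 0) (hδν : δ.card ≤ ν) (hε : ε < ν.ord) :
    testSet (ν.ord * δ + ε) = coverMap ν.ord δ '' testSet ε := by
  have hν0 : ν.ord ≠ 0 := by
    rw [Ne, Cardinal.ord_eq_zero]; rintro rfl; exact absurd Cardinal.aleph0_pos hν.not_gt
  have hcard : (ν.ord * δ + ε).card = ν := by
    rw [card_add, card_mul, Cardinal.card_ord,
      Cardinal.mul_eq_left hν hδν (by simpa using hδ)]
    exact Cardinal.add_eq_left hν (Cardinal.lt_ord.1 hε).le
  have hω : ¬ ν.ord * δ + ε < ω := by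
    refine not_lt.2 ?_
    calc ω ≤ ν.ord := Cardinal.omega0_le_ord.2 hν
      _ ≤ ν.ord * δ := le_mul_left _ (pos_of_ne_zero hδ)
      _ ≤ _ := le_self_add
  rw [testSet, dif_neg hω, hcard, mul_add_div _ hν0, div_eq_zero_of_lt hε, add_zero,
    mul_add_mod_self, mod_eq_of_lt hε]

theorem coverMap_spec {ν : Cardinal.{0}} {α δ : Ordinal.{0}}
    (hδν : δ.card ≤ ν) (hα : α < ν.ord ∨ α < δ) : ∃ ζ < ν.ord, coverMap ν.ord δ ζ = α :=
  Classical.epsilon_spec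
    (exists_coverMap (by rwa [Cardinal.card_ord])) α hα

theorem exists_ord_eq_opow {ν : Cardinal.{0}} (hν : Cardinal.aleph0 ≤ ν) :
    ∃ σ : Ordinal.{0}, ν.ord = ω ^ σ := by
  rcases isPrincipal_add_iff_zero_or_omega0_opow.1 (isPrincipal_add_ord hν) with h | ⟨σ, h⟩
  · rw [Cardinal.ord_eq_zero] at h; subst h; exact absurd Cardinal.aleph0_pos hν.not_gt
  · exact ⟨σ, h.symm⟩

theorem omega0_mul_ord {ν : Cardinal.{0}} (hν : Cardinal.aleph0 < ν) : ω * ν.ord = ν.ord := by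
  have h : ω < ν.ord := by rw [← Cardinal.ord_aleph0]; exact Cardinal.ord_lt_ord.2 hν
  have h2 : (2 : Ordinal.{0}) < ν.ord := (natCast_lt_omega0 2).trans h
  exact (isPrincipal_mul_iff_mul_left_eq.1 (isPrincipal_mul_ord hν.le)) ω omega0_pos h

/-- If all blocks of length `ω` whose index has `α` in its test set have upper mean at most `p`,
then so does the whole sequence. -/
theorem upperMean_le_of_testSet {C p : ℝ} (a : Cardinal.{0}) :
    Cardinal.aleph0 ≤ a → ∀ α < a.ord, ∀ g : Ordinal.{0} → ℝ, (∀ ζ, |g ζ| ≤ C) →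
      (∀ γ < a.ord, α ∈ testSet γ → upperMean ω (fun ζ => g (ω * γ + ζ)) ≤ p) →
      upperMean (ω * a.ord) g ≤ p := by
  induction a using WellFoundedLT.induction with
  | ind a ih =>
  intro ha α hα g hg H
  rcases ha.eq_or_lt with rfl | ha'
  · rw [Cardinal.ord_aleph0] at hα H ⊢
    obtain ⟨k, rfl⟩ := lt_omega0.1 hα
    have := upperMean_opow_succ_le (σ := 1) (p := p) hg (k + 1) fun i hi => by
      rw [opow_one]
      refine H i (natCast_lt_omega0 i) ?_
      rw [testSet_of_lt_omega0 (natCast_lt_omega0 i), mem_Iio]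
      exact_mod_cast hi
    rwa [opow_succ, opow_one] at this
  rw [omega0_mul_ord ha']
  obtain ⟨σ, hσ⟩ := exists_ord_eq_opow ha
  have hωa : ω < a.ord := by rw [← Cardinal.ord_aleph0]; exact Cardinal.ord_lt_ord.2 ha'
  have hmul := isPrincipal_mul_ord ha
  have hadd := isPrincipal_add_ord ha
  have hσ0 : σ ≠ 0 := by
    rintro rfl
    rw [hσ, opow_zero] at hωa
    exact absurd one_lt_omega0 hωa.not_gt
  set ν₀ := max Cardinal.aleph0 α.card with hν₀
  have hν₀a : ν₀ < a := max_lt ha' (Cardinal.lt_ord.1 hα)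
  have hν₀' : Cardinal.aleph0 ≤ ν₀ := le_max_left _ _
  have hων₀ : ω ≤ ν₀.ord := Cardinal.omega0_le_ord.2 hν₀'
  have h1a : (1 : Ordinal.{0}) < a.ord := one_lt_omega0.trans hωa
  have hζ : ω * ν₀.ord * (α + 1) * ω < a.ord :=
    hmul (hmul (hmul hωa (Cardinal.ord_lt_ord.2 hν₀a)) (hadd hα h1a)) hωa
  rw [hσ] at hζ ⊢
  refine upperMean_opow_le hσ0 hg hζ fun ξ h1 h2 => ?_
  rw [← hσ] at h2 hζ
  have hα1 : α + 1 ≠ 0 := by simp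
  have hle0 : ω * ν₀.ord ≤ ξ :=
    ((le_mul_left _ (pos_of_ne_zero hα1)).trans (le_mul_left _ omega0_pos)).trans h1
  have hle1 : ν₀.ord ≤ ξ := (le_mul_right _ omega0_pos).trans hle0
  have hν₀ξ : ν₀ ≤ ξ.card := Cardinal.ord_le.1 hle1
  set ν := ξ.card with hν
  have hν' : Cardinal.aleph0 ≤ ν := hν₀'.trans hν₀ξ
  have hνa : ν < a := Cardinal.lt_ord.1 h2
  have hνa' : ν.ord < a.ord := Cardinal.ord_lt_ord.2 hνa
  have hν0 : ν.ord ≠ 0 := (omega0_pos.trans_le (Cardinal.omega0_le_ord.2 hν')).ne'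
  have hνξ : ω * ν.ord ≤ ξ := by
    rcases hν'.eq_or_lt with h | h
    · rw [← h, Cardinal.ord_aleph0]
      exact (mul_le_mul_right hων₀ ω).trans hle0
    · rw [omega0_mul_ord h]; exact Cardinal.ord_card_le ξ
  have block : ∀ δ, δ ≠ 0 → α < ν.ord ∨ α < δ → ω * ν.ord * δ ≤ ξ →
      upperMean (ω * ν.ord) (fun ζ => g (ω * ν.ord * δ + ζ)) ≤ p := by
    intro δ hδ hαδ hδξ
    have hδξ' : δ ≤ ξ :=
      (le_mul_right _ (pos_of_ne_zero (mul_ne_zero omega0_pos.ne' hν0))).trans hδξ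
    have hδν : δ.card ≤ ν := card_le_card hδξ'
    obtain ⟨ζ, hζν, hζ⟩ := coverMap_spec hδν hαδ
    refine ih ν hνa hν' ζ hζν _ (fun _ => hg _) fun γ hγ hζγ => ?_
    have := H (ν.ord * δ + γ) (hadd (hmul hνa' (hδξ'.trans_lt h2)) (hγ.trans hνa')) (by
      rw [testSet_mul_add hν' hδ hδν hγ, ← hζ]; exact mem_image_of_mem _ hζγ)
    simpa only [mul_add, mul_assoc, add_assoc] using this
  obtain ⟨τ, hτ⟩ : ∃ τ : Ordinal.{0}, ω * ν.ord = ω ^ τ := by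
    obtain ⟨τ, hτ⟩ := exists_ord_eq_opow hν'
    exact ⟨1 + τ, by rw [hτ, opow_add, opow_one]⟩
  by_cases hαν : α < ν.ord
  · rw [hτ] at block hνξ
    refine upperMean_le_of_blocks ξ g hg hνξ fun δ hδ => ?_
    rcases eq_or_ne δ 0 with rfl | hδ0
    · have := ih ν hνa hν' α hαν g hg fun γ hγ => H γ (hγ.trans hνa')
      rw [hτ] at this
      simpa using this
    · exact block δ hδ0 (Or.inl hαν) (le_self_add.trans hδ)
  · have hνeq : ν₀ = ν := hν₀ξ.antisymm
      ((Cardinal.ord_le.1 (not_lt.1 hαν)).trans (le_max_right _ _))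
    rw [hνeq, hτ] at h1
    rw [hτ] at block
    refine upperMean_le_of_eventually_blocks hα1 hg h1 fun δ hδ hδξ => ?_
    have hlt : α < δ := (lt_add_one α).trans_le hδ
    exact block δ (bot_lt_iff_ne_bot.1 (bot_le.trans_lt hlt)) (Or.inr hlt) (le_self_add.trans hδξ)

theorem exists_injective_forall_mem {ι E : Type} (A : ι → Set E)
    (h : ∀ i, Cardinal.mk ι ≤ Cardinal.mk (A i)) :
    ∃ f : ι → E, Function.Injective f ∧ ∀ i, f i ∈ A i := by
  obtain ⟨r, wo, hr⟩ := Cardinal.exists_ord_eq ι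
  rcases isEmpty_or_nonempty ι with hι | ⟨⟨i₀⟩⟩
  · exact ⟨isEmptyElim, fun i => isEmptyElim i, fun i => isEmptyElim i⟩
  have hne : (A i₀).Nonempty := by
    rw [← Set.nonempty_coe_sort, ← Cardinal.mk_ne_zero_iff]
    exact ((Cardinal.mk_ne_zero_iff.2 ⟨i₀⟩).bot_lt.trans_le (h i₀)).ne'
  have hE : Nonempty E := ⟨hne.some⟩
  let f : ι → E := wo.wf.fix fun i F =>
    Classical.epsilon fun y => y ∈ A i ∧ ∀ j, ∀ hj : r j i, F j hj ≠ y
  have hf : ∀ i, f i ∈ A i ∧ ∀ j, r j i → f j ≠ f i := by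
    intro i
    have h1 : f i = Classical.epsilon fun y => y ∈ A i ∧ ∀ j, ∀ _ : r j i, f j ≠ y :=
      wo.wf.fix_eq _ i
    rw [h1]
    refine Classical.epsilon_spec (p := fun y => y ∈ A i ∧ ∀ j, ∀ _ : r j i, f j ≠ y) ?_
    by_contra! hcon
    have hsub : A i ⊆ Set.range fun j : {j // r j i} => f j := by
      intro y hy
      obtain ⟨j, hj, hjy⟩ := hcon y hy
      exact ⟨⟨j, hj⟩, hjy⟩
    have h2 : Cardinal.mk {j // r j i} < Cardinal.mk ι := Cardinal.card_typein_lt (r := r) i hr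
    exact absurd ((h i).trans ((Cardinal.mk_le_mk_of_subset hsub).trans Cardinal.mk_range_le))
      h2.not_ge
  refine ⟨f, fun i j hij => ?_, fun i => (hf i).1⟩
  by_contra hne
  rcases trichotomous_of r i j with h' | h' | h'
  · exact (hf j).2 i h' hij
  · exact hne h'
  · exact (hf i).2 j h' hij.symm

theorem exists_bijOn_forall_mem {E : Type} {X : Set E} (hX : Cardinal.aleph0 < Cardinal.mk X)
    (A : Ordinal.{0} → Set E) (hAX : ∀ ξ, A ξ ⊆ X)
    (hA : ∀ ξ, Cardinal.mk X ≤ Cardinal.mk (A ξ)) :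
    ∃ x : Ordinal.{0} → E, BijOn x (Iio (Cardinal.mk X).ord) X ∧ (∀ ξ, x ξ ∈ X) ∧
      ∀ ξ < (Cardinal.mk X).ord, ξ % ω ≠ 0 → x ξ ∈ A ξ := by
  set κ := (Cardinal.mk X).ord with hκ
  have hωκ : ω * κ = κ := omega0_mul_ord hX
  obtain ⟨o⟩ : Nonempty (Iio κ ≃ X) := by
    rw [← Cardinal.lift_mk_eq', Cardinal.mk_Iio_ordinal, Cardinal.card_ord, Cardinal.lift_lift]
  have hX2 : Cardinal.mk (X × Bool) = Cardinal.mk X := by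
    rw [Cardinal.mk_prod, Cardinal.lift_id, Cardinal.lift_id]
    exact Cardinal.mul_eq_left hX.le
      (by simpa using (Cardinal.natCast_lt_aleph0 (n := 2)).le.trans hX.le) (by simp)
  obtain ⟨f, hf, hfA⟩ := exists_injective_forall_mem
    (fun i : X × Bool => A (o.symm i.1)) (fun i => hX2.trans_le (hA _))
  let T : Set (Iio κ) := {ξ | ξ.1 % ω ≠ 0}
  let Y : Set E := (fun ξ => f (o ξ, true)) '' T
  have hYX : Y ⊆ X := by
    rintro _ ⟨ξ, -, rfl⟩
    exact hAX _ (hfA _)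
  obtain ⟨e⟩ : Nonempty ((Tᶜ : Set (Iio κ)) ≃ (X \ Y : Set E)) := by
    rw [← Cardinal.lift_mk_eq']
    have h1 : Cardinal.mk (X \ Y : Set E) = Cardinal.mk X := by
      refine (Cardinal.mk_le_mk_of_subset sdiff_subset).antisymm ?_
      refine Cardinal.mk_le_of_injective (f := fun s : X => (⟨f (s, false), hAX _ (hfA _), ?_⟩ :
        (X \ Y : Set E))) ?_
      · rintro ⟨ξ, -, h⟩
        simpa using hf h
      · intro s t hst
        simpa using hf (congrArg Subtype.val hst)
    have h2 : Cardinal.mk (Tᶜ : Set (Iio κ)) = Cardinal.mk (Iio κ) := by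
      refine (Cardinal.mk_set_le _).antisymm ?_
      refine Cardinal.mk_le_of_injective (f := fun ξ : Iio κ => (⟨⟨ω * ξ.1, ?_⟩, ?_⟩ :
        (Tᶜ : Set (Iio κ)))) ?_
      · exact ((mul_lt_mul_iff_right₀ omega0_pos).2 ξ.2).trans_eq hωκ
      · simp [T]
      · intro ξ η h
        have h' : ω * ξ.1 = ω * η.1 := congrArg (fun z => z.1.1) h
        exact Subtype.ext ((mul_right_inj' omega0_pos.ne').1 h')
    rw [h1, h2, Cardinal.mk_Iio_ordinal, Cardinal.card_ord, Cardinal.lift_lift]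
  classical
  have hκ0 : (0 : Ordinal.{0}) ∈ Iio κ := by
    rw [mem_Iio, hκ, Cardinal.lt_ord]; simpa using Cardinal.aleph0_pos.trans hX
  let y : Iio κ → E := fun ξ => if h : ξ ∈ T then f (o ξ, true) else e ⟨ξ, h⟩
  have hyT : ∀ ξ ∈ T, y ξ = f (o ξ, true) := fun ξ h => dif_pos h
  have hyT' : ∀ ξ (h : ξ ∉ T), y ξ = e ⟨ξ, h⟩ := fun ξ h => dif_neg h
  have hyX : ∀ ξ, y ξ ∈ X := by
    intro ξ
    by_cases h : ξ ∈ T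
    · rw [hyT ξ h]; exact hAX _ (hfA _)
    · rw [hyT' ξ h]; exact (e ⟨ξ, h⟩).2.1
  have hyinj : Function.Injective y := by
    intro ξ η h
    by_cases h1 : ξ ∈ T <;> by_cases h2 : η ∈ T
    · rw [hyT ξ h1, hyT η h2] at h
      simpa using hf h
    · rw [hyT ξ h1, hyT' η h2] at h
      exact absurd ⟨ξ, h1, h⟩ (e ⟨η, h2⟩).2.2
    · rw [hyT' ξ h1, hyT η h2] at h
      exact absurd ⟨η, h2, h.symm⟩ (e ⟨ξ, h1⟩).2.2
    · rw [hyT' ξ h1, hyT' η h2] at h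
      simpa using e.injective (Subtype.ext h)
  have hysurj : ∀ s ∈ X, ∃ ξ, y ξ = s := by
    intro s hs
    by_cases h : s ∈ Y
    · obtain ⟨ξ, hξ, rfl⟩ := h
      exact ⟨ξ, hyT ξ hξ⟩
    · refine ⟨e.symm ⟨s, hs, h⟩, ?_⟩
      rw [hyT' _ (e.symm ⟨s, hs, h⟩).2]
      simp
  refine ⟨fun ξ => if h : ξ ∈ Iio κ then y ⟨ξ, h⟩ else y ⟨0, hκ0⟩,
    ⟨fun ξ hξ => ?_, fun ξ hξ η hη h => ?_, fun s hs => ?_⟩, fun ξ => ?_, fun ξ hξ hξω => ?_⟩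
  · simp only [dif_pos hξ]; exact hyX _
  · simp only [dif_pos hξ, dif_pos hη] at h
    simpa using hyinj h
  · obtain ⟨ξ, hξ⟩ := hysurj s hs
    refine ⟨ξ.1, ξ.2, ?_⟩
    simp only [dif_pos ξ.2]; exact hξ
  · dsimp only
    split_ifs <;> exact hyX _
  · simp only [dif_pos (mem_Iio.2 hξ)]
    rw [hyT ⟨ξ, hξ⟩ hξω]
    have h := hfA (o ⟨ξ, hξ⟩, true)
    simp only [o.symm_apply_apply] at h
    exact h

section LargeSets

variable {E : Type} [MeasurableSpace E] [StandardBorelSpace E] {μ : Measure E}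
  [NullSingletonClass μ]

theorem continuum_le_mk_of_measure_pos {S : Set E} (hS : NullMeasurableSet S μ) (h : 0 < μ S) :
    𝔠 ≤ #S := by
  obtain ⟨T, hTS, hT, hae⟩ := hS.exists_measurable_subset_ae_eq
  have hTpos : 0 < μ T := by rwa [measure_congr hae]
  have hnc : ¬ Countable T := fun hc => hTpos.ne' (Set.Countable.measure_zero hc μ)
  have := hT.standardBorel
  have e : T ≃ᵐ ℝ := PolishSpace.measurableEquivOfNotCountable hnc
    not_countable
  rw [← Cardinal.mk_real, ← Cardinal.mk_congr e.toEquiv]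
  exact Cardinal.mk_le_mk_of_subset hTS

theorem mk_le_continuum_of_standardBorelSpace (E : Type) [MeasurableSpace E]
    [StandardBorelSpace E] : #E ≤ 𝔠 := by
  by_cases h : Countable E
  · exact (Cardinal.mk_le_aleph0_iff.2 h).trans Cardinal.aleph0_le_continuum
  · have e : E ≃ᵐ ℝ := PolishSpace.measurableEquivOfNotCountable h
      not_countable
    rw [Cardinal.mk_congr e.toEquiv, Cardinal.mk_real]

end LargeSets

theorem mk_measurable_le_continuum (E : Type) [MeasurableSpace E]
    [MeasurableSpace.CountablyGenerated E] : #{φ : E → ℝ // Measurable φ} ≤ 𝔠 := by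
  obtain ⟨b, hb, hgen⟩ := MeasurableSpace.CountablyGenerated.isCountablyGenerated (α := E)
  have h1 : #{s : Set E // MeasurableSet s} ≤ 𝔠 := by
    have := MeasurableSpace.cardinal_measurableSet_le_continuum (s := b)
      ((Cardinal.le_aleph0_iff_set_countable.2 hb).trans Cardinal.aleph0_le_continuum)
    rw [← hgen] at this
    exact this
  refine (Cardinal.mk_le_of_injective (f := fun (φ : {φ : E → ℝ // Measurable φ}) (q : ℚ) =>
    (⟨{t | φ.1 t < q}, measurableSet_lt φ.2 measurable_const⟩ : {s : Set E // MeasurableSet s}))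
    ?_).trans (b := #(ℚ → {s : Set E // MeasurableSet s})) ?_
  · intro φ ψ h
    have h' : ∀ t (q : ℚ), φ.1 t < q ↔ ψ.1 t < q := fun t q =>
      Set.ext_iff.1 (congrArg Subtype.val (congrFun h q)) t
    ext t
    refine le_antisymm (le_of_forall_rat_lt_imp_le fun q hq => ?_)
      (le_of_forall_rat_lt_imp_le fun q hq => ?_)
    · by_contra! hc
      exact absurd ((h' t q).2 hc) hq.not_gt
    · by_contra! hc
      exact absurd ((h' t q).1 hc) hq.not_gt
  · rw [← Cardinal.power_def, Cardinal.mk_denumerable ℚ]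
    exact (Cardinal.power_le_power_right h1).trans_eq Cardinal.continuum_power_aleph0

theorem exists_forall_exists_lt_ord_eq {β : Type} [Nonempty β] {a : Cardinal.{0}} (h : #β ≤ a) :
    ∃ Φ : Ordinal.{0} → β, ∀ b, ∃ α < a.ord, Φ α = b := by
  obtain ⟨e⟩ : Nonempty (β ↪ Iio a.ord) := by
    rw [← Cardinal.lift_mk_le', Cardinal.mk_Iio_ordinal, Cardinal.card_ord,
      Cardinal.lift_id'.{0, 1}]
    simpa using h
  classical
  refine ⟨fun ξ => if h : ∃ b, (e b).1 = ξ then h.choose else Classical.arbitrary β,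
    fun b => ⟨(e b).1, (e b).2, ?_⟩⟩
  have h1 : ∃ b', (e b').1 = (e b).1 := ⟨b, rfl⟩
  simp only [dif_pos h1]
  exact e.injective (Subtype.ext h1.choose_spec)

section LawOfLargeNumbers

variable {E : Type} [MeasurableSpace E] (P : Measure E)

theorem ae_tendsto_average_infinitePi [IsProbabilityMeasure P] {φ : E → ℝ} (hφ : Measurable φ)
    (hφi : Integrable φ P) :
    ∀ᵐ t ∂(Measure.infinitePi fun _ : ℕ => P),
      Tendsto (fun n : ℕ => (∑ i ∈ Finset.range n, φ (t i)) / n) atTop (𝓝 (∫ s, φ s ∂P)) := by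
  have hmp := fun i : ℕ => measurePreserving_eval_infinitePi (fun _ : ℕ => P) i
  have hlaw : ∀ i : ℕ, Measure.map (fun t : ℕ → E => φ (t i)) (Measure.infinitePi fun _ => P) =
      Measure.map φ P := by
    intro i
    have h := Measure.map_map (μ := Measure.infinitePi fun _ : ℕ => P) hφ (hmp i).measurable
    rw [(hmp i).map_eq] at h
    exact h.symm
  have hm : ∀ i : ℕ, AEMeasurable (fun t : ℕ → E => φ (t i)) (Measure.infinitePi fun _ => P) :=
    fun i => (hφ.comp (hmp i).measurable).aemeasurable
  have h := strong_law_ae_real (μ := Measure.infinitePi fun _ : ℕ => P)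
    (fun (i : ℕ) (t : ℕ → E) => φ (t i)) ((hmp 0).integrable_comp_of_integrable hφi)
    (fun i j hij => (iIndepFun_infinitePi (P := fun _ : ℕ => P) (X := fun _ => φ)
      (fun _ => hφ)).indepFun hij)
    (fun i => ⟨hm i, hm 0, by rw [hlaw, hlaw]⟩)
  have h2 : (∫ t : ℕ → E, φ (t 0) ∂(Measure.infinitePi fun _ : ℕ => P)) = ∫ s, φ s ∂P := by
    have h := integral_map (μ := Measure.infinitePi fun _ : ℕ => P)
      (hmp 0).measurable.aemeasurable hφ.aestronglyMeasurable
    rw [(hmp 0).map_eq] at h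
    exact h.symm
  rw [h2] at h
  exact h

theorem ae_measure_fiber_pos {K : Set (E → ℝ)} (hK : K.Finite)
    (hKm : ∀ φ ∈ K, Measurable φ ∧ (range φ).Finite) :
    ∀ᵐ s ∂P, 0 < P {u | ∀ φ ∈ K, φ u = φ s} := by
  have := hK.to_subtype
  let F : E → K → ℝ := fun s φ => φ.1 s
  have hfib : ∀ s, {u | ∀ φ ∈ K, φ u = φ s} = F ⁻¹' {F s} := by
    intro s
    ext u
    simp [F, funext_iff]
  have hF : (range F).Finite := by
    refine (Set.Finite.pi (t := fun φ : K => range φ.1) fun φ => (hKm φ.1 φ.2).2).subset ?_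
    rintro _ ⟨s, rfl⟩ φ -
    exact ⟨s, rfl⟩
  rw [ae_iff]
  refine measure_mono_null (t := ⋃ y ∈ {y ∈ range F | P (F ⁻¹' {y}) = 0}, F ⁻¹' {y}) ?_ ?_
  · intro s hs
    have hs' : P (F ⁻¹' {F s}) = 0 := by
      simpa [hfib] using hs
    exact mem_biUnion (x := F s) ⟨⟨s, rfl⟩, hs'⟩ rfl
  · exact (measure_biUnion_null_iff (hF.subset (sep_subset _ _)).countable).2 fun y hy => hy.2

theorem exists_seq_tendsto_average [IsProbabilityMeasure P] {K : Set (E → ℝ)} (hK : K.Finite)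
    (hKm : ∀ φ ∈ K, Measurable φ ∧ (range φ).Finite) :
    ∃ t : ℕ → E, (∀ φ ∈ K, Tendsto (fun n : ℕ => (∑ i ∈ Finset.range n, φ (t i)) / n) atTop
      (𝓝 (∫ s, φ s ∂P))) ∧ ∀ j, 0 < P {u | ∀ φ ∈ K, φ u = φ (t j)} := by
  have h1 := (ae_ball_iff hK.countable).2 fun φ (hφ : φ ∈ K) =>
    ae_tendsto_average_infinitePi P (hKm φ hφ).1 (by
      obtain ⟨C, hC⟩ := (hKm φ hφ).2.isBounded.exists_norm_le
      exact .of_bound (hKm φ hφ).1.aestronglyMeasurable C (ae_of_all _ fun s => hC _ ⟨s, rfl⟩))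
  have h2 : ∀ᵐ t ∂(Measure.infinitePi fun _ : ℕ => P), ∀ j,
      0 < P {u | ∀ φ ∈ K, φ u = φ (t j)} := ae_all_iff.2 fun j =>
    (measurePreserving_eval_infinitePi (fun _ : ℕ => P) j).quasiMeasurePreserving.ae
      (ae_measure_fiber_pos P hK hKm)
  exact (h1.and h2).exists

end LawOfLargeNumbers

section WellOrdering

variable {E : Type} [MeasurableSpace E] [StandardBorelSpace E]

theorem upperMean_omega0_le_of_eq {C p : ℝ} {g : Ordinal.{0} → ℝ} (hg : ∀ ξ, |g ξ| ≤ C)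
    {u : ℕ → ℝ} (hu : Tendsto (fun n : ℕ => (∑ i ∈ Finset.range n, u i) / n) atTop (𝓝 p))
    (h : ∀ j : ℕ, j ≠ 0 → g j = u j) : upperMean ω g ≤ p := by
  refine upperMean_omega0_le hg ?_
  have h1 : Tendsto (fun n : ℕ => (∑ i ∈ Finset.range n, u i) / n + (g 0 - u 0) / n) atTop
      (𝓝 (p + 0)) :=
    hu.add (tendsto_const_nhds.div_atTop tendsto_natCast_atTop_atTop)
  rw [add_zero] at h1
  refine h1.congr' ?_
  filter_upwards [eventually_ge_atTop 1] with n hn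
  obtain ⟨m, rfl⟩ := Nat.exists_eq_add_of_le' hn
  rw [← add_div, Finset.sum_range_succ', Finset.sum_range_succ',
    Finset.sum_congr rfl fun i _ => h (i + 1) i.succ_ne_zero]
  congr 1
  simp

/-- There is an enumeration of `X` in its initial ordinal along which the upper mean of every
simple function is at most its average over `X`. -/
theorem exists_bijOn_upperMean_simple_le (μ : Measure E) [NullSingletonClass μ] {X : Set E}
    (hX : NullMeasurableSet X μ) (hpos : 0 < μ X) (hfin : μ X < ⊤) :
    ∃ x : Ordinal.{0} → E, BijOn x (Iio (#X).ord) X ∧ (∀ ξ, x ξ ∈ X) ∧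
      ∀ φ : E → ℝ, Measurable φ → (range φ).Finite →
        upperMean (#X).ord (fun ξ => φ (x ξ)) ≤ ∫ s, φ s ∂((μ X)⁻¹ • μ.restrict X) := by
  set P := (μ X)⁻¹ • μ.restrict X with hP
  have hPprob : IsProbabilityMeasure P := ⟨by
    rw [hP, Measure.smul_apply, Measure.restrict_apply_univ, _root_.smul_eq_mul,
      ENNReal.inv_mul_cancel hpos.ne' hfin.ne]⟩
  have hXc : #X = 𝔠 := ((Cardinal.mk_set_le X).trans
    (mk_le_continuum_of_standardBorelSpace E)).antisymm (continuum_le_mk_of_measure_pos hX hpos)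
  have hXω : ℵ₀ < #X := hXc ▸ Cardinal.aleph0_lt_continuum
  have hβ : Nonempty {φ : E → ℝ // Measurable φ ∧ (range φ).Finite} :=
    ⟨⟨fun _ => 0, measurable_const, finite_range_const⟩⟩
  obtain ⟨Φ, hΦ⟩ := exists_forall_exists_lt_ord_eq (β := {φ : E → ℝ // Measurable φ ∧
    (range φ).Finite}) (a := #X) <| by
      rw [hXc]
      refine (Cardinal.mk_le_of_injective (f := fun φ => (⟨φ.1, φ.2.1⟩ :
        {φ : E → ℝ // Measurable φ})) fun φ ψ h => ?_).trans (mk_measurable_le_continuum E)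
      exact Subtype.ext (congrArg (fun z => z.1) h)
  let K : Ordinal.{0} → Set (E → ℝ) := fun γ => (fun α => (Φ α).1) '' testSet γ
  have hKfin : ∀ γ, (K γ).Finite := fun γ => (finite_testSet γ).image _
  have hKm : ∀ γ, ∀ φ ∈ K γ, Measurable φ ∧ (range φ).Finite := by
    rintro γ _ ⟨α, -, rfl⟩
    exact (Φ α).2
  choose t ht htpos using fun γ => exists_seq_tendsto_average P (hKfin γ) (hKm γ)
  let F : Ordinal.{0} → ℕ → Set E := fun γ j => {u | ∀ φ ∈ K γ, φ u = φ (t γ j)}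
  have hFm : ∀ γ j, MeasurableSet (F γ j) := by
    intro γ j
    have : F γ j = ⋂ φ ∈ K γ, φ ⁻¹' {φ (t γ j)} := by ext; simp [F]
    rw [this]
    exact .biInter (hKfin γ).countable fun φ hφ => (hKm γ φ hφ).1 (measurableSet_singleton _)
  have hFX : ∀ γ j, #X ≤ #(X ∩ F γ j : Set E) := by
    intro γ j
    rw [hXc]
    refine continuum_le_mk_of_measure_pos (μ := μ) (hX.inter (hFm γ j).nullMeasurableSet) ?_
    have h := htpos γ j
    rw [hP, Measure.smul_apply, Measure.restrict_apply (hFm γ j), _root_.smul_eq_mul] at h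
    rw [inter_comm]
    exact pos_of_ne_zero (right_ne_zero_of_mul h.ne')
  obtain ⟨x, hx, hxX, hxF⟩ := exists_bijOn_forall_mem hXω
    (fun ξ => X ∩ F (ξ / ω) (Cardinal.toNat (ξ % ω).card)) (fun ξ => inter_subset_left)
    (fun ξ => hFX _ _)
  refine ⟨x, hx, hxX, fun φ hφ hφfin => ?_⟩
  obtain ⟨C, hC⟩ := hφfin.isBounded.exists_norm_le
  have hC' : ∀ s, |φ s| ≤ C := fun s => hC _ ⟨s, rfl⟩
  obtain ⟨α, hα, hαφ⟩ := hΦ ⟨φ, hφ, hφfin⟩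
  rw [← omega0_mul_ord hXω]
  refine upperMean_le_of_testSet _ hXω.le α hα _ (fun _ => hC' _) fun γ hγ hαγ => ?_
  have hφK : φ ∈ K γ := ⟨α, hαγ, by simp only [hαφ]⟩
  refine upperMean_omega0_le_of_eq (fun _ => hC' _) (ht γ φ hφK) fun j hj => ?_
  have hlt : ω * γ + j < (#X).ord := by
    rw [← omega0_mul_ord hXω]
    calc ω * γ + j < ω * γ + ω := by gcongr; exact natCast_lt_omega0 j
      _ = ω * Order.succ γ := (mul_succ _ _).symm
      _ ≤ ω * (#X).ord := by gcongr; exact Order.succ_le_of_lt hγ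
  have hmod : (ω * γ + j) % ω = j := by
    rw [mul_add_mod_self, mod_eq_of_lt (natCast_lt_omega0 j)]
  have hdiv : (ω * γ + j) / ω = γ := by
    rw [mul_add_div _ omega0_ne_zero, div_eq_zero_of_lt (natCast_lt_omega0 j), add_zero]
  have hmem := hxF (ω * γ + j) hlt (by rw [hmod]; exact_mod_cast hj)
  rw [hmod, hdiv] at hmem
  simpa using hmem.2 φ hφK

end WellOrdering

section Bounded

variable {E : Type} [MeasurableSpace E]

theorem exists_simple_ge_integral_le {P : Measure E} [IsProbabilityMeasure P] {X : Set E}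
    (hPX : ∀ᵐ s ∂P, s ∈ X) {f : E → ℝ} (hf : AEMeasurable f P) {C : ℝ}
    (hC : ∀ s ∈ X, |f s| ≤ C) {ε : ℝ} (hε : 0 < ε) :
    ∃ φ : E → ℝ, Measurable φ ∧ (range φ).Finite ∧ (∀ s ∈ X, f s ≤ φ s) ∧
      ∫ s, φ s ∂P ≤ ∫ s, f s ∂P + ε := by
  classical
  obtain ⟨s₀, hs₀⟩ := hPX.exists
  have hC0 : 0 ≤ C := (abs_nonneg _).trans (hC s₀ hs₀)
  let g := hf.mk f
  let N := toMeasurable P {s | f s ≠ g s}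
  have hN : ∀ᵐ s ∂P, s ∉ N := by
    rw [ae_iff]
    simp only [not_not]
    exact (measure_toMeasurable _).trans (ae_iff.1 hf.ae_eq_mk)
  have hfg : ∀ s, s ∉ N → f s = g s := fun s hs => by
    by_contra h
    exact hs (subset_toMeasurable P _ h)
  let r : ℝ → ℝ := fun y => ε * (⌊max (-C) (min C y) / ε⌋ + 1)
  have hr : Measurable r := by fun_prop
  have hrfin : (range r).Finite := by
    refine ((Set.finite_Icc ⌊-C / ε⌋ ⌊C / ε⌋).image fun k : ℤ => ε * ((k : ℝ) + 1)).subset ?_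
    rintro _ ⟨y, rfl⟩
    refine ⟨_, ⟨?_, ?_⟩, rfl⟩
    · gcongr; exact le_max_left _ _
    · gcongr; exact max_le (by linarith) (min_le_left _ _)
  have hrC : ∀ y, |y| ≤ C → y ≤ r y ∧ r y ≤ y + ε := by
    intro y hy
    have h1 : max (-C) (min C y) = y := by
      rw [min_eq_right (abs_le.1 hy).2, max_eq_right (abs_le.1 hy).1]
    have h2 : ε * (y / ε) = y := mul_div_cancel₀ y hε.ne'
    simp only [r, h1]
    constructor
    · have := mul_le_mul_of_nonneg_left (Int.lt_floor_add_one (y / ε)).le hε.le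
      linarith
    · have := mul_le_mul_of_nonneg_left (Int.floor_le (y / ε)) hε.le
      linarith
  let φ : E → ℝ := N.piecewise (fun _ => C) (fun s => r (g s))
  have hφ : Measurable φ := Measurable.piecewise (measurableSet_toMeasurable _ _) measurable_const
    (hr.comp hf.measurable_mk)
  have hφfin : (range φ).Finite := by
    refine (hrfin.insert C).subset ?_
    rintro _ ⟨s, rfl⟩
    by_cases hs : s ∈ N
    · exact .inl (piecewise_eq_of_mem _ _ _ hs)
    · exact .inr ⟨g s, (piecewise_eq_of_notMem N (fun _ => C) (fun s => r (g s)) hs).symm⟩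
  refine ⟨φ, hφ, hφfin, fun s hs => ?_, ?_⟩
  · by_cases hsN : s ∈ N
    · rw [show φ s = C from piecewise_eq_of_mem _ _ _ hsN]
      exact (abs_le.1 (hC s hs)).2
    · rw [show φ s = r (g s) from piecewise_eq_of_notMem _ _ _ hsN, ← hfg s hsN]
      exact (hrC _ (hC s hs)).1
  · obtain ⟨D, hD⟩ := hφfin.isBounded.exists_norm_le
    have hφi : Integrable φ P :=
      .of_bound hφ.aestronglyMeasurable D (ae_of_all _ fun s => hD _ ⟨s, rfl⟩)
    have hfi : Integrable f P :=
      .of_bound hf.aestronglyMeasurable C (hPX.mono fun s hs => hC s hs)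
    calc ∫ s, φ s ∂P ≤ ∫ s, f s + ε ∂P := by
          refine integral_mono_ae hφi (hfi.add (integrable_const ε)) ?_
          filter_upwards [hPX, hN] with s hs hsN
          rw [show φ s = r (g s) from piecewise_eq_of_notMem _ _ _ hsN, ← hfg s hsN]
          exact (hrC _ (hC s hs)).2
      _ = ∫ s, f s ∂P + ε := by
          rw [integral_add hfi (integrable_const ε)]
          simp

theorem hasMean_of_upperMean_le {o : Ordinal.{0}} {s : Ordinal.{0} → ℝ} {C c : ℝ}
    (hs : ∀ ξ, |s ξ| ≤ C) (h : upperMean o s ≤ c) (h' : upperMean o (fun ξ => -s ξ) ≤ -c) :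
    HasMean o s c := by
  have h0 : upperMean o (fun _ => 0) ≤ upperMean o s + upperMean o (fun ξ => -s ξ) :=
    upperMean_le_add (Ch := 0) o s (fun ξ => -s ξ) (fun _ => 0) hs
      (fun ξ => (abs_neg _).trans_le (hs ξ)) (by simp) (by simp)
  rw [upperMean_zero_seq] at h0
  refine ⟨by linarith, ?_⟩
  rw [lowerMean]
  linarith

/-- A subset of finite positive measure of a standard Borel space with an atomless measure can be
enumerated in its initial ordinal so that integrals over it become transfinite means. -/
theorem exists_bijOn_hasMean_average [StandardBorelSpace E] (μ : Measure E) [NullSingletonClass μ]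
    {X : Set E} (hX : NullMeasurableSet X μ) (hpos : 0 < μ X) (hfin : μ X < ⊤) :
    ∃ x : Ordinal.{0} → E, BijOn x (Iio (#X).ord) X ∧
      ∀ f : E → ℝ, AEMeasurable f (μ.restrict X) → (∃ C : ℝ, ∀ t ∈ X, |f t| ≤ C) →
        HasMean (#X).ord (fun ξ => f (x ξ)) (∫ s, f s ∂((μ X)⁻¹ • μ.restrict X)) := by
  obtain ⟨x, hx, hxX, H⟩ := exists_bijOn_upperMean_simple_le μ hX hpos hfin
  refine ⟨x, hx, fun f hf ⟨C, hC⟩ => ?_⟩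
  set P := (μ X)⁻¹ • μ.restrict X with hP
  have hPprob : IsProbabilityMeasure P := ⟨by
    rw [hP, Measure.smul_apply, Measure.restrict_apply_univ, _root_.smul_eq_mul,
      ENNReal.inv_mul_cancel hpos.ne' hfin.ne]⟩
  have hPX : ∀ᵐ s ∂P, s ∈ X := Measure.ae_smul_measure (ae_restrict_mem₀ hX) _
  have key : ∀ g : E → ℝ, AEMeasurable g (μ.restrict X) → (∀ t ∈ X, |g t| ≤ C) →
      upperMean (#X).ord (fun ξ => g (x ξ)) ≤ ∫ s, g s ∂P := by
    intro g hg hgC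
    refine le_of_forall_pos_le_add fun ε hε => ?_
    obtain ⟨φ, hφ, hφfin, hgφ, hφi⟩ :=
      exists_simple_ge_integral_le hPX (hg.smul_measure (μ X)⁻¹) hgC hε
    obtain ⟨D, hD⟩ := hφfin.isBounded.exists_norm_le
    calc upperMean (#X).ord (fun ξ => g (x ξ))
        ≤ upperMean (#X).ord (fun ξ => φ (x ξ)) :=
          upperMean_mono _ (fun ξ => hD _ ⟨x ξ, rfl⟩) (fun ξ => hgC _ (hxX ξ))
            (fun ξ => hgφ _ (hxX ξ))
      _ ≤ ∫ s, φ s ∂P := H φ hφ hφfin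
      _ ≤ _ := hφi
  refine hasMean_of_upperMean_le (fun ξ => hC _ (hxX ξ)) (key f hf hC) ?_
  rw [← integral_neg]
  exact key (fun s => -f s) hf.neg fun t ht => (abs_neg _).trans_le (hC t ht)

theorem exists_bijOn_hasMean_of_subsingleton [Subsingleton E] (μ : Measure E) {X : Set E}
    (hpos : 0 < μ X) :
    ∃ x : Ordinal.{0} → E, BijOn x (Iio (#X).ord) X ∧
      ∀ f : E → ℝ, ∃ c : ℝ, HasMean (#X).ord (fun ξ => f (x ξ)) c ∧
        ∫ t in X, f t ∂μ = (μ X).toReal * c := by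
  obtain ⟨p, hp⟩ := nonempty_of_measure_ne_zero hpos.ne'
  obtain rfl : X = {p} := Set.Subsingleton.eq_singleton_of_mem (Set.subsingleton_of_subsingleton) hp
  have h1 : (#({p} : Set E)).ord = 1 := by rw [Cardinal.mk_singleton, Cardinal.ord_one]
  rw [h1]
  refine ⟨fun _ => p, ⟨fun _ _ => rfl, fun ξ hξ η hη _ => ?_, fun s hs => ⟨0, by simp, hs.symm⟩⟩,
    fun f => ⟨f p, ⟨upperMean_one _, by rw [lowerMean, upperMean_one, neg_neg]⟩, ?_⟩⟩
  · rw [Order.lt_one_iff.1 (mem_Iio.1 hξ), Order.lt_one_iff.1 (mem_Iio.1 hη)]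
  · have : f = fun _ => f p := funext fun s => congrArg f (Subsingleton.elim s p)
    rw [this, setIntegral_const, Measure.real, _root_.smul_eq_mul]

end Bounded

end TransfiniteMean

/-- Theorem: integrals as transfinite means.  Let `X ⊆ ℝⁿ` be a
Lebesgue measurable set of finite positive Lebesgue measure.  Then there is a
bijection `x` from the ordinals below the initial ordinal of `card X` onto `X`
such that for every bounded Lebesgue measurable `f : X → ℝ` the mean `𝕄(f ∘ x)`
exists and `∫_X f = m(X) · 𝕄(f ∘ x)`. -/
theorem exists_wellOrdering_integral_eq_mean (n : ℕ) (X : Set (Fin n → ℝ))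
    (hX : NullMeasurableSet X volume)
    (hpos : 0 < volume X) (hfin : volume X < ⊤) :
    ∃ x : Ordinal.{0} → (Fin n → ℝ),
      Set.BijOn x (Set.Iio (Cardinal.mk X).ord) X ∧
      ∀ f : (Fin n → ℝ) → ℝ,
        AEMeasurable f (volume.restrict X) →
        (∃ C : ℝ, ∀ t ∈ X, |f t| ≤ C) →
        ∃ c : ℝ, HasMean (Cardinal.mk X).ord (fun ξ => f (x ξ)) c ∧
          ∫ t in X, f t = (volume X).toReal * c := by
  rcases n.eq_zero_or_pos with rfl | hn
  · obtain ⟨x, hx, H⟩ := TransfiniteMean.exists_bijOn_hasMean_of_subsingleton volume hpos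
    exact ⟨x, hx, fun f _ _ => H f⟩
  · have : Nonempty (Fin n) := ⟨⟨0, hn⟩⟩
    obtain ⟨x, hx, H⟩ := TransfiniteMean.exists_bijOn_hasMean_average volume hX hpos hfin
    refine ⟨x, hx, fun f hf hC => ⟨_, H f hf hC, ?_⟩⟩
    rw [integral_smul_measure, ENNReal.toReal_inv, _root_.smul_eq_mul, mul_inv_cancel_left₀]
    exact (ENNReal.toReal_pos hpos.ne' hfin.ne).ne'
end

section
/- Let κ be an infinite cardinal whose cofinality is greater than ω, regarded as an ordinal, and let s be a bounded transfinite sequence of reals of length κ. Then (a) there is an ordinal ξ_ω < κ such that sup_{ξ_ω ≤ ξ < κ} M̄(s|_ξ) = M̄(s); and (b) if the mean 𝕄(s) exists, then there is an ordinal ξ_s < κ such that for every ξ with ξ_s ≤ ξ < κ, the mean 𝕄(s|_ξ) exists and equals 𝕄(s). -/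
open Ordinal

theorem upperMean_zero (f : Ordinal.{0} → ℝ) : upperMean 0 f = 0 := by
  rw [upperMean]
  simp

theorem upperMean_one (f : Ordinal.{0} → ℝ) : upperMean 1 f = f 0 := by
  rw [upperMean]
  simp

theorem upperMean_of_indecomposable {o : Ordinal.{0}} (h1 : 1 < o)
    (ho : o = omega0 ^ log omega0 o) (f : Ordinal.{0} → ℝ) :
    upperMean o f =
      ⨅ ζ : Set.Ico (1 : Ordinal.{0}) o, ⨆ ξ : Set.Ico ζ.1 o, upperMean ξ.1 f := by
  rw [upperMean, if_neg h1.ne', dif_pos ⟨h1, ho⟩]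

theorem upperMean_of_decomposable {o : Ordinal.{0}} (h1 : 1 < o)
    (ho : o ≠ omega0 ^ log omega0 o) (f : Ordinal.{0} → ℝ) :
    upperMean o f = ((stdBlocks o : ℝ))⁻¹ *
      ∑ i ∈ Finset.range (stdBlocks o),
        upperMean (omega0 ^ log omega0 o)
          (fun ξ => f (omega0 ^ log omega0 o * (i : Ordinal) + ξ)) := by
  rw [upperMean, if_neg h1.ne', dif_neg fun h => ho h.2, dif_pos h1]

/-- A principle of induction following the recursive definition of the upper mean. -/
theorem induction_on_indecomposable {P : Ordinal.{0} → Prop} (h0 : P 0) (h1 : P 1)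
    (hlim : ∀ o, 1 < o → o = omega0 ^ log omega0 o → (∀ ξ < o, P ξ) → P o)
    (hdec : ∀ o, 1 < o → o ≠ omega0 ^ log omega0 o → P (omega0 ^ log omega0 o) → P o)
    (o : Ordinal.{0}) : P o := by
  induction o using WellFoundedLT.induction with
  | ind o ih =>
    rcases lt_trichotomy o 1 with h | rfl | h
    · rw [Order.lt_one_iff] at h
      exact h ▸ h0
    · exact h1
    · by_cases ho : o = omega0 ^ log omega0 o
      · exact hlim o h ho ih
      · exact hdec o h ho (ih _ (lt_of_le_of_ne
          (opow_log_le_self _ (zero_lt_one.trans h).ne') (Ne.symm ho)))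

theorem natCast_stdBlocks (o : Ordinal.{0}) :
    (stdBlocks o : Ordinal.{0}) = o / omega0 ^ log omega0 o := by
  obtain ⟨n, hn⟩ := lt_omega0.1 (div_opow_log_lt o one_lt_omega0)
  simp [stdBlocks, hn]

theorem block_index_lt {o ξ : Ordinal.{0}} {i : ℕ} (hi : i < stdBlocks o)
    (hξ : ξ < omega0 ^ log omega0 o) : omega0 ^ log omega0 o * (i : Ordinal) + ξ < o := by
  have h : ((i + 1 : ℕ) : Ordinal.{0}) ≤ o / omega0 ^ log omega0 o := by
    rw [← natCast_stdBlocks]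
    exact_mod_cast hi
  rw [← Ordinal.mul_le_iff_le_div (opow_pos _ omega0_pos).ne'] at h
  refine lt_of_lt_of_le ?_ h
  rw [Nat.cast_add_one, mul_add_one]
  gcongr

theorem abs_upperMean_le {C : ℝ} (hC : 0 ≤ C) (o : Ordinal.{0}) :
    ∀ f : Ordinal.{0} → ℝ, (∀ ξ < o, |f ξ| ≤ C) → |upperMean o f| ≤ C := by
  induction o using induction_on_indecomposable with
  | h0 => simpa [upperMean_zero] using hC
  | h1 => exact fun f hf => by simpa [upperMean_one] using hf 0 zero_lt_one
  | hlim o h1 ho ih =>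
    intro f hf
    have hb : ∀ ξ < o, |upperMean ξ f| ≤ C := fun ξ hξ =>
      ih ξ hξ f fun η hη => hf η (hη.trans hξ)
    have hup : ∀ ζ : Set.Ico (1 : Ordinal.{0}) o,
        (⨆ ξ : Set.Ico ζ.1 o, upperMean ξ.1 f) ≤ C := fun ζ => by
      have : Nonempty (Set.Ico ζ.1 o) := ⟨⟨ζ.1, le_rfl, ζ.2.2⟩⟩
      exact ciSup_le fun ξ => (abs_le.1 (hb ξ.1 ξ.2.2)).2
    have hlo : ∀ ζ : Set.Ico (1 : Ordinal.{0}) o,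
        -C ≤ ⨆ ξ : Set.Ico ζ.1 o, upperMean ξ.1 f := fun ζ =>
      le_ciSup_of_le ⟨C, by rintro _ ⟨ξ, rfl⟩; exact (abs_le.1 (hb ξ.1 ξ.2.2)).2⟩
        ⟨ζ.1, le_rfl, ζ.2.2⟩ (abs_le.1 (hb ζ.1 ζ.2.2)).1
    have : Nonempty (Set.Ico (1 : Ordinal.{0}) o) := ⟨⟨1, le_rfl, h1⟩⟩
    rw [upperMean_of_indecomposable h1 ho, abs_le]
    exact ⟨le_ciInf hlo, ciInf_le_of_le ⟨-C, by rintro _ ⟨ζ, rfl⟩; exact hlo ζ⟩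
      ⟨1, le_rfl, h1⟩ (hup _)⟩
  | hdec o h1 ho ih =>
    intro f hf
    rw [upperMean_of_decomposable h1 ho, abs_mul, abs_of_nonneg (by positivity)]
    have hsum := (Finset.abs_sum_le_sum_abs (fun i : ℕ => upperMean (omega0 ^ log omega0 o)
      (fun ξ => f (omega0 ^ log omega0 o * (i : Ordinal) + ξ))) (Finset.range (stdBlocks o))).trans
      (Finset.sum_le_card_nsmul _ _ C fun i hi => ih _ fun ξ hξ =>
        hf _ (block_index_lt (Finset.mem_range.1 hi) hξ))
    rw [Finset.card_range, _root_.nsmul_eq_mul] at hsum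
    exact inv_mul_le_of_le_mul₀ (by positivity) hC hsum

theorem SeqBounded.exists_nonneg {o : Ordinal.{0}} {f : Ordinal.{0} → ℝ} (hf : SeqBounded o f) :
    ∃ C : ℝ, 0 ≤ C ∧ ∀ ξ < o, |f ξ| ≤ C := by
  obtain ⟨C, hC⟩ := hf
  exact ⟨max C 0, le_max_right _ _, fun ξ hξ => (hC ξ hξ).trans (le_max_left _ _)⟩

theorem SeqBounded.neg {o : Ordinal.{0}} {f : Ordinal.{0} → ℝ} (hf : SeqBounded o f) :
    SeqBounded o fun ξ => -f ξ := by
  simpa only [SeqBounded, abs_neg] using hf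

theorem SeqBounded.mono {o a : Ordinal.{0}} {f : Ordinal.{0} → ℝ} (hf : SeqBounded o f)
    (ha : a ≤ o) : SeqBounded a f :=
  hf.imp fun _ hC ξ hξ => hC ξ (hξ.trans_le ha)

theorem bddAbove_range_upperMean {o : Ordinal.{0}} {f : Ordinal.{0} → ℝ} (hf : SeqBounded o f)
    (ζ : Ordinal.{0}) : BddAbove (Set.range fun ξ : Set.Ico ζ o => upperMean ξ.1 f) := by
  obtain ⟨C, hC0, hC⟩ := hf.exists_nonneg
  refine ⟨C, ?_⟩
  rintro _ ⟨ξ, rfl⟩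
  exact (abs_le.1 (abs_upperMean_le hC0 ξ.1 f fun η hη => hC η (hη.trans ξ.2.2))).2

theorem bddBelow_range_iSup_upperMean {o : Ordinal.{0}} {f : Ordinal.{0} → ℝ}
    (hf : SeqBounded o f) : BddBelow (Set.range fun ζ : Set.Ico (1 : Ordinal.{0}) o =>
      ⨆ ξ : Set.Ico ζ.1 o, upperMean ξ.1 f) := by
  obtain ⟨C, hC0, hC⟩ := hf.exists_nonneg
  refine ⟨-C, ?_⟩
  rintro _ ⟨ζ, rfl⟩
  exact le_ciSup_of_le (bddAbove_range_upperMean hf ζ.1) ⟨ζ.1, le_rfl, ζ.2.2⟩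
    (abs_le.1 (abs_upperMean_le hC0 ζ.1 f fun η hη => hC η (hη.trans ζ.2.2))).1

theorem upperMean_add_upperMean_neg_nonneg (o : Ordinal.{0}) :
    ∀ f : Ordinal.{0} → ℝ, SeqBounded o f →
      0 ≤ upperMean o f + upperMean o fun ξ => -f ξ := by
  induction o using induction_on_indecomposable with
  | h0 => simp [upperMean_zero]
  | h1 => simp [upperMean_one]
  | hlim o h1 ho ih =>
    intro f hf
    have : Nonempty (Set.Ico (1 : Ordinal.{0}) o) := ⟨⟨1, le_rfl, h1⟩⟩
    rw [upperMean_of_indecomposable h1 ho, upperMean_of_indecomposable h1 ho,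
      ← neg_le_iff_add_nonneg']
    refine le_ciInf fun ζ₂ => ?_
    rw [neg_le]
    refine le_ciInf fun ζ₁ => ?_
    have hm : max ζ₁.1 ζ₂.1 < o := max_lt ζ₁.2.2 ζ₂.2.2
    have h₁ := le_ciSup (bddAbove_range_upperMean hf ζ₁.1) ⟨max ζ₁.1 ζ₂.1, le_max_left _ _, hm⟩
    have h₂ := le_ciSup (bddAbove_range_upperMean hf.neg ζ₂.1)
      ⟨max ζ₁.1 ζ₂.1, le_max_right _ _, hm⟩
    have h₃ := ih _ hm f (hf.mono hm.le)
    dsimp only at h₁ h₂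
    linarith
  | hdec o h1 ho ih =>
    intro f ⟨C, hC⟩
    rw [upperMean_of_decomposable h1 ho, upperMean_of_decomposable h1 ho, ← mul_add,
      ← Finset.sum_add_distrib]
    exact mul_nonneg (by positivity) (Finset.sum_nonneg fun i hi => ih _
      ⟨C, fun ξ hξ => hC _ (block_index_lt (Finset.mem_range.1 hi) hξ)⟩)

theorem lowerMean_le_upperMean {o : Ordinal.{0}} {f : Ordinal.{0} → ℝ} (hf : SeqBounded o f) :
    lowerMean o f ≤ upperMean o f :=
  neg_le_iff_add_nonneg.2 (upperMean_add_upperMean_neg_nonneg o f hf)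

theorem ord_eq_omega0_opow_log {κ : Cardinal.{0}} (hκ : Cardinal.aleph0 ≤ κ) :
    κ.ord = omega0 ^ log omega0 κ.ord := by
  rcases isPrincipal_add_iff_zero_or_omega0_opow.1 (isPrincipal_add_ord hκ) with h | ⟨a, ha⟩
  · exact absurd (Cardinal.ord_eq_zero.1 h) (Cardinal.aleph0_pos.trans_le hκ).ne'
  · rw [← ha]
    dsimp only
    rw [log_opow one_lt_omega0]

theorem one_lt_ord {κ : Cardinal.{0}} (hκ : Cardinal.aleph0 ≤ κ) : 1 < κ.ord :=
  one_lt_omega0.trans_le (Cardinal.ord_aleph0 ▸ Cardinal.ord_le_ord.2 hκ)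

theorem exists_iSup_upperMean_eq {κ : Cardinal.{0}} (hκ : Cardinal.aleph0 ≤ κ)
    (hcof : Cardinal.aleph0 < κ.ord.cof) {s : Ordinal.{0} → ℝ} (hs : SeqBounded κ.ord s) :
    ∃ ξω : Ordinal.{0}, 0 < ξω ∧ ξω < κ.ord ∧
      (⨆ ξ : Set.Ico ξω κ.ord, upperMean ξ.1 s) = upperMean κ.ord s := by
  have h1 := one_lt_ord hκ
  have : Nonempty (Set.Ico (1 : Ordinal.{0}) κ.ord) := ⟨⟨1, le_rfl, h1⟩⟩
  rw [upperMean_of_indecomposable h1 (ord_eq_omega0_opow_log hκ)]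
  set M := ⨅ ζ : Set.Ico (1 : Ordinal.{0}) κ.ord, ⨆ ξ : Set.Ico ζ.1 κ.ord, upperMean ξ.1 s
  choose ζ hζ using fun n : ℕ => exists_lt_of_ciInf_lt
    (lt_add_of_pos_right M (Nat.one_div_pos_of_nat (α := ℝ) (n := n)))
  have hbdd : BddAbove (Set.range fun n => (ζ n).1) :=
    ⟨κ.ord, by rintro _ ⟨n, rfl⟩; exact (ζ n).2.2.le⟩
  have hle : ∀ n, (ζ n).1 ≤ ⨆ n, (ζ n).1 := fun n => le_ciSup hbdd n
  have hlt : ⨆ n, (ζ n).1 < κ.ord :=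
    Ordinal.iSup_lt_of_lt_cof (by simpa using hcof) fun n => (ζ n).2.2
  have h1le : 1 ≤ ⨆ n, (ζ n).1 := (ζ 0).2.1.trans (hle 0)
  refine ⟨⨆ n, (ζ n).1, zero_lt_one.trans_le h1le, hlt, le_antisymm ?_ ?_⟩
  · have : Nonempty (Set.Ico (⨆ n, (ζ n).1) κ.ord) := ⟨⟨_, le_rfl, hlt⟩⟩
    refine ciSup_le fun ξ => le_of_forall_pos_lt_add fun ε hε => ?_
    obtain ⟨n, hn⟩ := exists_nat_one_div_lt hε
    have h := le_ciSup (bddAbove_range_upperMean hs (ζ n).1)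
      ⟨ξ.1, (hle n).trans ξ.2.1, ξ.2.2⟩
    exact (h.trans_lt (hζ n)).trans (by gcongr)
  · exact ciInf_le (bddBelow_range_iSup_upperMean hs)
      (⟨_, h1le, hlt⟩ : Set.Ico (1 : Ordinal.{0}) κ.ord)

/-- Lemma 7.1.  Let `κ` be an infinite cardinal of cofinality
`> ω` and `s` a bounded sequence of length `κ` (as an ordinal, `κ.ord`).  Then
(a) there is `ξ_ω < κ` (which may be taken nonzero) with
`sup_{ξ_ω ≤ ξ < κ} M̄(s|_ξ) = M̄(s)`, and
(b) if the mean `𝕄(s)` exists then there is `ξ_s < κ` such that for all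
`ξ_s ≤ ξ < κ` the mean `𝕄(s|_ξ)` exists and equals `𝕄(s)`. -/
theorem upperMean_stabilizes (κ : Cardinal.{0}) (hκ : Cardinal.aleph0 ≤ κ)
    (hcof : Cardinal.aleph0 < κ.ord.cof)
    (s : Ordinal.{0} → ℝ) (hs : SeqBounded κ.ord s) :
    (∃ ξω : Ordinal.{0}, 0 < ξω ∧ ξω < κ.ord ∧
        (⨆ ξ : Set.Ico ξω κ.ord, upperMean ξ.1 s) = upperMean κ.ord s) ∧
      ∀ c : ℝ, HasMean κ.ord s c →
        ∃ ξs : Ordinal.{0}, ξs < κ.ord ∧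
          ∀ ξ, ξs ≤ ξ → ξ < κ.ord → HasMean ξ s c := by
  refine ⟨exists_iSup_upperMean_eq hκ hcof hs, ?_⟩
  rintro c ⟨hup, hlow⟩
  obtain ⟨a, -, ha, hsa⟩ := exists_iSup_upperMean_eq hκ hcof hs
  obtain ⟨b, -, hb, hsb⟩ := exists_iSup_upperMean_eq hκ hcof hs.neg
  refine ⟨max a b, max_lt ha hb, fun ξ hξ hξκ => ?_⟩
  have h₁ := le_ciSup (bddAbove_range_upperMean hs a) ⟨ξ, (le_max_left _ _).trans hξ, hξκ⟩
  have h₂ := le_ciSup (bddAbove_range_upperMean hs.neg b) ⟨ξ, (le_max_right _ _).trans hξ, hξκ⟩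
  have h₃ := lowerMean_le_upperMean (hs.mono hξκ.le)
  rw [hsa, hup] at h₁
  rw [hsb] at h₂
  unfold HasMean lowerMean at *
  dsimp only at h₁ h₂
  constructor <;> linarith
end
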